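/- arXiv:1806.02248 — 5 statements merged into one kernel-verified Lean document; each statement's English description precedes it below -/
import Mathlib

section
/- Let L ≥ 1 and let i ≠ j be items in [L] = {1,…,L}. Let α : [L] → ℝ satisfy α(i) ≥ α(j) > 0, let v assign to every permutation a of [L] and every position k ∈ [L] a real number v(a,k) with 0 ≤ v(a,k) ≤ 1, and let σ be the transposition of [L] exchanging i and j, acting on permutations by (σ∘a)(k) = σ(a(k)). Let p be a probability mass function on the permutations of [L] with p(a) = p(σ∘a) for every permutation a, and suppose v(a, a⁻¹(i)) ≥ (α(i)/α(j))·v(σ∘a, a⁻¹(i)) for every permutation a. Define p_i = Σ_a p(a)·v(a, a⁻¹(i)) and p_j = Σ_a p(a)·v(a, a⁻¹(j)). Then for every real number r with 0 < r ≤ p_i + p_j one has (p_i − p_j)/r ≥ (α(i) − α(j))/(α(i) + α(j)). -/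
/-- core of Lemma 1(a), reformulated over the randomization
distribution `p` of the algorithm's action. Items are elements of `Fin L`,
permutations act so that `a k` is the item at position `k`, and `a.symm i`
is the position of item `i`; `Equiv.swap i j * a` is the permutation
`σ ∘ a` with `(σ ∘ a) k = σ (a k)`. -/
theorem stmt0 (L : ℕ) (hL : 1 ≤ L) (i j : Fin L) (hij : i ≠ j)
    (α : Fin L → ℝ) (hαij : α i ≥ α j) (hαj : 0 < α j)
    (v : Equiv.Perm (Fin L) → Fin L → ℝ)
    (hv0 : ∀ a k, 0 ≤ v a k) (hv1 : ∀ a k, v a k ≤ 1)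
    (p : Equiv.Perm (Fin L) → ℝ)
    (hp0 : ∀ a, 0 ≤ p a) (hp1 : ∑ a : Equiv.Perm (Fin L), p a = 1)
    (hpswap : ∀ a : Equiv.Perm (Fin L), p a = p (Equiv.swap i j * a))
    (hvswap : ∀ a : Equiv.Perm (Fin L),
      v a (a.symm i) ≥ (α i / α j) * v (Equiv.swap i j * a) (a.symm i))
    (pi pj : ℝ)
    (hpi : pi = ∑ a : Equiv.Perm (Fin L), p a * v a (a.symm i))
    (hpj : pj = ∑ a : Equiv.Perm (Fin L), p a * v a (a.symm j)) :
    ∀ r : ℝ, 0 < r → r ≤ pi + pj →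
      (pi - pj) / r ≥ (α i - α j) / (α i + α j) := by
  intro r hr hrle
  have hpj_swap : pj = ∑ a : Equiv.Perm (Fin L), p a * v (Equiv.swap i j * a) (a.symm i) := by
    rw [hpj, ← Equiv.sum_comp (Equiv.mulLeft (Equiv.swap i j))]
    refine Finset.sum_congr rfl fun a _ => ?_
    have hpos : (Equiv.swap i j * a).symm j = a.symm i := by
      rw [Equiv.symm_apply_eq]
      simp
    rw [Equiv.coe_mulLeft, hpos, ← hpswap a]
  have hratio : α i / α j * pj ≤ pi := by
    rw [hpj_swap, hpi, Finset.mul_sum]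
    refine Finset.sum_le_sum fun a _ => ?_
    calc α i / α j * (p a * v (Equiv.swap i j * a) (a.symm i))
        = p a * (α i / α j * v (Equiv.swap i j * a) (a.symm i)) := by ring
      _ ≤ p a * v a (a.symm i) := mul_le_mul_of_nonneg_left (hvswap a) (hp0 a)
  have hcross : α i * pj ≤ pi * α j := by
    rwa [div_mul_eq_mul_div, div_le_iff₀ hαj] at hratio
  rw [ge_iff_le, div_le_div_iff₀ (by linarith) hr]
  have hscale : (α i - α j) * r ≤ (α i - α j) * (pi + pj) :=
    mul_le_mul_of_nonneg_left hrle (sub_nonneg.mpr hαij)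
  linarith
end

section
/- Let L ≥ 1 and let i ≠ j be items in [L] = {1,…,L}. Let α : [L] → ℝ be nonnegative, let v assign to every permutation a of [L] and every position k ∈ [L] a real number v(a,k) with 0 ≤ v(a,k) ≤ 1, and let σ be the transposition of [L] exchanging i and j, acting on permutations by (σ∘a)(k) = σ(a(k)). Let p be a probability mass function on the permutations of [L] with p(a) = p(σ∘a) for every permutation a, and suppose α(j)·v(a, a⁻¹(i)) ≥ α(i)·v(σ∘a, a⁻¹(i)) for every permutation a. Define p_i = Σ_a p(a)·v(a, a⁻¹(i)) and p_j = Σ_a p(a)·v(a, a⁻¹(j)). Then α(j)·p_i ≥ α(i)·p_j. -/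
/-- the exchange step in the proof of Lemma 1. Items are
elements of `Fin L`; `a.symm i` is the position of item `i`, and
`Equiv.swap i j * a` is the permutation `σ ∘ a` with `(σ ∘ a) k = σ (a k)`. -/
theorem stmt1 (L : ℕ) (hL : 1 ≤ L) (i j : Fin L) (hij : i ≠ j)
    (α : Fin L → ℝ) (hα : ∀ k, 0 ≤ α k)
    (v : Equiv.Perm (Fin L) → Fin L → ℝ)
    (hv0 : ∀ a k, 0 ≤ v a k) (hv1 : ∀ a k, v a k ≤ 1)
    (p : Equiv.Perm (Fin L) → ℝ)
    (hp0 : ∀ a, 0 ≤ p a) (hp1 : ∑ a : Equiv.Perm (Fin L), p a = 1)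
    (hpswap : ∀ a : Equiv.Perm (Fin L), p a = p (Equiv.swap i j * a))
    (hvswap : ∀ a : Equiv.Perm (Fin L),
      α j * v a (a.symm i) ≥ α i * v (Equiv.swap i j * a) (a.symm i))
    (pi pj : ℝ)
    (hpi : pi = ∑ a : Equiv.Perm (Fin L), p a * v a (a.symm i))
    (hpj : pj = ∑ a : Equiv.Perm (Fin L), p a * v a (a.symm j)) :
    α j * pi ≥ α i * pj := by
  have symm_swap_mul (a : Equiv.Perm (Fin L)) :
      (Equiv.swap i j * a).symm j = a.symm i := by
    rw [Equiv.symm_apply_eq]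
    simp
  have pj_eq : pj = ∑ a : Equiv.Perm (Fin L),
      p a * v (Equiv.swap i j * a) (a.symm i) := by
    rw [hpj, ← Equiv.sum_comp (Equiv.mulLeft (Equiv.swap i j))]
    refine Finset.sum_congr rfl fun a _ => ?_
    rw [Equiv.coe_mulLeft, symm_swap_mul, ← hpswap]
  rw [hpi, pj_eq, Finset.mul_sum, Finset.mul_sum]
  refine Finset.sum_le_sum fun a _ => ?_
  rw [mul_left_comm, mul_left_comm (α j)]
  exact mul_le_mul_of_nonneg_left (hvswap a) (hp0 a)
end

section
/- Let c = 4√(2/π)/erf(√2), let δ ∈ (0,1), let n and N be natural numbers with 1 ≤ N ≤ n, let a > 0 be real, and let S be a real number satisfying a·N − √(2·N·log(c·√N/δ)) ≤ S and S ≤ 1 + √(2·N·log(c·√N/δ)). Then S ≤ 1 + (6/a)·log(c·√n/δ). -/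
open Real

/-- The Gauss error function `erf x = (2/√π) ∫₀ˣ exp(−t²) dt`. -/
noncomputable def erf (x : ℝ) : ℝ :=
  (2 / Real.sqrt Real.pi) * ∫ t in (0:ℝ)..x, Real.exp (-t ^ 2)

theorem integral_exp_neg_sq_pos {x : ℝ} (hx : 0 < x) :
    0 < ∫ t in (0:ℝ)..x, Real.exp (-t ^ 2) :=
  intervalIntegral.intervalIntegral_pos_of_pos
    ((by fun_prop : Continuous fun t : ℝ => Real.exp (-t ^ 2)).intervalIntegrable 0 x)
    (fun t => Real.exp_pos _) hx

theorem integral_exp_neg_sq_le {x : ℝ} (hx : 0 ≤ x) :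
    ∫ t in (0:ℝ)..x, Real.exp (-t ^ 2) ≤ x := by
  have h : ∫ t in (0:ℝ)..x, Real.exp (-t ^ 2) ≤ ∫ _ in (0:ℝ)..x, (1:ℝ) :=
    intervalIntegral.integral_mono_on hx
      ((by fun_prop : Continuous fun t : ℝ => Real.exp (-t ^ 2)).intervalIntegrable 0 x)
      (by simp) (fun t _ => Real.exp_le_one_iff.2 (neg_nonpos.2 (sq_nonneg t)))
  simpa using h

theorem two_le_four_mul_sqrt_two_div_pi_div_erf :
    2 ≤ 4 * Real.sqrt (2 / Real.pi) / erf (Real.sqrt 2) := by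
  have hs : 0 < Real.sqrt 2 := by positivity
  have hp : 0 < Real.sqrt Real.pi := Real.sqrt_pos.2 Real.pi_pos
  have hpos := integral_exp_neg_sq_pos hs
  have hle := integral_exp_neg_sq_le hs.le
  rw [erf, Real.sqrt_div zero_le_two, le_div_iff₀ (by positivity)]
  calc 2 * (2 / Real.sqrt Real.pi * ∫ t in (0:ℝ)..Real.sqrt 2, Real.exp (-t ^ 2))
      ≤ 2 * (2 / Real.sqrt Real.pi * Real.sqrt 2) := by gcongr
    _ = 4 * (Real.sqrt 2 / Real.sqrt Real.pi) := by ring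

/-- arithmetic core of Lemma 5 of the paper. -/
theorem stmt5 (c δ a S : ℝ) (n N : ℕ)
    (hc : c = 4 * Real.sqrt (2 / Real.pi) / erf (Real.sqrt 2))
    (hδ0 : 0 < δ) (hδ1 : δ < 1) (hN : 1 ≤ N) (hNn : N ≤ n) (ha : 0 < a)
    (h1 : a * N - Real.sqrt (2 * N * Real.log (c * Real.sqrt N / δ)) ≤ S)
    (h2 : S ≤ 1 + Real.sqrt (2 * N * Real.log (c * Real.sqrt N / δ))) :
    S ≤ 1 + (6 / a) * Real.log (c * Real.sqrt n / δ) := by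
  have hc2 : 2 ≤ c := hc ▸ two_le_four_mul_sqrt_two_div_pi_div_erf
  have hN1 : (1:ℝ) ≤ N := by exact_mod_cast hN
  have hsN : 1 ≤ Real.sqrt N := Real.one_le_sqrt.2 hN1
  have harg : 2 ≤ c * Real.sqrt N / δ := by
    rw [le_div_iff₀ hδ0]
    nlinarith
  have hmono : Real.log (c * Real.sqrt N / δ) ≤ Real.log (c * Real.sqrt n / δ) := by
    apply Real.log_le_log (by linarith)
    gcongr
  have hL : 1 / 2 ≤ Real.log (c * Real.sqrt N / δ) := by
    linarith [Real.log_two_gt_d9, Real.log_le_log zero_lt_two harg]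
  set L := Real.log (c * Real.sqrt N / δ)
  set r := Real.sqrt (2 * N * L)
  have hr0 : 0 ≤ r := Real.sqrt_nonneg _
  have hr2 : r ^ 2 = 2 * N * L := Real.sq_sqrt (by positivity)
  have hrN : r ≤ 2 * L * N := by
    have hLN : 1 ≤ 2 * L * N := by nlinarith
    refine (sq_le_sq₀ hr0 (by positivity)).1 ?_
    nlinarith
  have har : a * r ≤ 6 * L := by
    have hmul : a * N * r ≤ (1 + 2 * r) * r :=
      mul_le_mul_of_nonneg_right (by linarith) hr0
    refine le_of_mul_le_mul_right (a := (N:ℝ)) ?_ (by linarith)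
    nlinarith
  have hfin : r ≤ 6 / a * Real.log (c * Real.sqrt n / δ) := by
    rw [div_mul_eq_mul_div, le_div_iff₀ ha]
    linarith
  linarith
end

section
/- Let (Ω, F, P) be a probability space, n ≥ 1, and let F_0 ⊆ F_1 ⊆ ⋯ ⊆ F_n be a filtration. Let X_1, …, X_n be random variables with X_t measurable with respect to F_t and X_t(ω) ∈ {−1, 0, 1} for all ω. For each t let G_t be the σ-algebra generated by F_{t−1} together with |X_t|, and let μ_t be a G_t-measurable random variable with |μ_t| ≤ 1 almost surely and E[X_t | G_t] = μ_t·|X_t| almost surely. Define S_t = Σ_{s=1}^t (X_s − μ_s·|X_s|) and N_t = Σ_{s=1}^t |X_s|. Then for every δ ∈ (0,1), with c = 4√(2/π)/erf(√2), P( there exists t ≤ n with N_t > 0 and |S_t| ≥ √(2·N_t·log(c·√(N_t)/δ)) ) ≤ δ. -/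
open MeasureTheory

open scoped ENNReal

/-- Hoeffding's lemma for a `{-1, 1}`-valued random variable of mean `m`. -/
lemma cosh_add_mul_sinh_le_exp {m : ℝ} (hm : |m| ≤ 1) (l : ℝ) :
    Real.cosh l + m * Real.sinh l ≤ Real.exp (l * m + l ^ 2 / 2) := by
  obtain ⟨h1, h2⟩ := abs_le.mp hm
  set Q : Measure ℝ := ENNReal.ofReal ((1 + m) / 2) • Measure.dirac 1 +
    ENNReal.ofReal ((1 - m) / 2) • Measure.dirac (-1) with hQ
  have hp : (0 : ℝ) ≤ (1 + m) / 2 := by linarith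
  have hq : (0 : ℝ) ≤ (1 - m) / 2 := by linarith
  have : IsProbabilityMeasure Q := by
    constructor
    simp only [hQ, Measure.coe_add, Measure.coe_smul, Pi.add_apply, Pi.smul_apply,
      measure_univ, smul_eq_mul, mul_one]
    rw [← ENNReal.ofReal_add hp hq]
    norm_num [← add_div]
  have hint : ∀ f : ℝ → ℝ, ∫ x, f x ∂Q = (1 + m) / 2 * f 1 + (1 - m) / 2 * f (-1) := by
    intro f
    have hi : ∀ a : ℝ, Integrable f (Measure.dirac a) := fun a =>
      integrable_dirac (by simp)
    rw [hQ, integral_add_measure ((hi _).smul_measure ENNReal.ofReal_ne_top)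
      ((hi _).smul_measure ENNReal.ofReal_ne_top)]
    simp [integral_smul_measure, ENNReal.toReal_ofReal hp, ENNReal.toReal_ofReal hq]
  have hb : ∀ᵐ x ∂Q, (fun x : ℝ => x) x ∈ Set.Icc (-1 : ℝ) 1 := by
    rw [hQ, ae_add_measure_iff]
    constructor <;> refine Measure.ae_smul_measure ?_ _ <;> simp [ae_dirac_eq]
  have key := (ProbabilityTheory.hasSubgaussianMGF_of_mem_Icc
    (μ := Q) (X := fun x : ℝ => x) (by fun_prop) hb).mgf_le l
  have hmean : ∫ x, x ∂Q = m := by rw [hint (fun x => x)]; ring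
  rw [ProbabilityTheory.mgf, hint, hmean] at key
  have hc : (((‖(1 : ℝ) - -1‖₊ / 2) ^ 2 : NNReal) : ℝ) = 1 := by norm_num
  rw [hc, one_mul] at key
  rw [Real.exp_add, Real.cosh_eq, Real.sinh_eq]
  calc _ = Real.exp (l * m) * ((1 + m) / 2 * Real.exp (l * (1 - m)) +
        (1 - m) / 2 * Real.exp (l * (-1 - m))) := by
        rw [mul_sub, mul_sub, Real.exp_sub, Real.exp_sub]
        field_simp
        ring_nf
    _ ≤ _ := by gcongr

/-- One step of the exponential supermartingale. -/
lemma integral_mul_exp_le {Ω : Type*} {F : MeasurableSpace Ω} {P : Measure Ω}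
    [IsProbabilityMeasure P] {G : MeasurableSpace Ω} (hG : G ≤ F) {X ν Z : Ω → ℝ}
    (hX : Measurable[F] X) (hXval : ∀ ω, X ω = -1 ∨ X ω = 0 ∨ X ω = 1)
    (hXabs : Measurable[G] fun ω => |X ω|) (hν : Measurable[G] ν) (hν1 : ∀ ω, |ν ω| ≤ 1)
    (hcond : P[X | G] =ᵐ[P] fun ω => ν ω * |X ω|)
    (hZ : Measurable[G] Z) (hZ0 : ∀ ω, 0 ≤ Z ω) {C : ℝ} (hZC : ∀ ω, Z ω ≤ C) (l : ℝ) :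
    Integrable (fun ω => Z ω * Real.exp (l * (X ω - ν ω * |X ω|) - l ^ 2 * |X ω| / 2)) P ∧
    ∫ ω, Z ω * Real.exp (l * (X ω - ν ω * |X ω|) - l ^ 2 * |X ω| / 2) ∂P ≤ ∫ ω, Z ω ∂P := by
  have hXle : ∀ ω, |X ω| ≤ 1 := fun ω => by rcases hXval ω with h | h | h <;> simp [h]
  set W : Ω → ℝ := fun ω => Z ω * Real.exp (-(l * (ν ω * |X ω|)) - l ^ 2 * |X ω| / 2) with hW
  have hWm : Measurable[G] W := by
    exact hZ.mul (Real.measurable_exp.comp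
      (((hν.mul hXabs).const_mul l).neg.sub ((hXabs.const_mul (l ^ 2)).div_const 2)))
  have hW0 : ∀ ω, 0 ≤ W ω := fun ω => mul_nonneg (hZ0 ω) (Real.exp_pos _).le
  have hWC : ∀ ω, ‖W ω‖ ≤ C * Real.exp |l| := by
    intro ω
    rw [Real.norm_of_nonneg (hW0 ω)]
    refine mul_le_mul (hZC ω) (Real.exp_le_exp.mpr ?_) (Real.exp_pos _).le
      ((hZ0 ω).trans (hZC ω))
    have h1 : -(l * (ν ω * |X ω|)) ≤ |l| := by
      refine (neg_le_abs _).trans ?_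
      rw [abs_mul, abs_mul, abs_abs]
      exact mul_le_of_le_one_right (abs_nonneg l)
        (mul_le_one₀ (hν1 ω) (abs_nonneg _) (hXle ω))
    have h2 : 0 ≤ l ^ 2 * |X ω| / 2 := by positivity
    linarith
  have hXi : Integrable X P :=
    Integrable.of_bound hX.aestronglyMeasurable 1 (Filter.Eventually.of_forall hXle)
  have hWi : Integrable W P :=
    Integrable.of_bound (hWm.mono hG le_rfl).aestronglyMeasurable _
      (Filter.Eventually.of_forall hWC)
  have hZi : Integrable Z P :=
    Integrable.of_bound (hZ.mono hG le_rfl).aestronglyMeasurable C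
      (Filter.Eventually.of_forall fun ω => by
        rw [Real.norm_of_nonneg (hZ0 ω)]; exact hZC ω)
  have hbi : ∀ f : Ω → ℝ, Measurable[F] f → (∀ ω, |f ω| ≤ 1) →
      Integrable (fun ω => W ω * f ω) P := fun f hf hf1 =>
    hWi.mul_bdd hf.aestronglyMeasurable (Filter.Eventually.of_forall hf1)
  have hνX : Integrable (fun ω => W ω * (ν ω * |X ω|)) P := by
    refine hbi _ ((hν.mul hXabs).mono hG le_rfl) fun ω => ?_
    rw [abs_mul, abs_abs]
    exact mul_le_one₀ (hν1 ω) (abs_nonneg _) (hXle ω)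
  have hWX : Integrable (fun ω => W ω * X ω) P := hbi _ hX hXle
  have hWa : Integrable (fun ω => W ω * |X ω|) P :=
    hbi _ (hXabs.mono hG le_rfl) fun ω => by rw [abs_abs]; exact hXle ω
  have hpull : ∫ ω, W ω * X ω ∂P = ∫ ω, W ω * (ν ω * |X ω|) ∂P := by
    rw [← integral_condExp hG]
    refine integral_congr_ae ?_
    have := condExp_mul_of_stronglyMeasurable_left (μ := P) hWm.stronglyMeasurable hWX hXi
    filter_upwards [this, hcond] with ω h1 h2
    rw [show (fun ω => W ω * X ω) = W * X from rfl, h1, Pi.mul_apply, h2]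
  have hexp : (fun ω => Z ω * Real.exp (l * (X ω - ν ω * |X ω|) - l ^ 2 * |X ω| / 2)) =
      fun ω => (W ω + (Real.cosh l - 1) * (W ω * |X ω|)) + Real.sinh l * (W ω * X ω) := by
    funext ω
    have h1 : Real.exp (l * X ω) =
        1 + (Real.cosh l - 1) * |X ω| + Real.sinh l * X ω := by
      rcases hXval ω with h | h | h <;> simp [h, Real.cosh_eq, Real.sinh_eq] <;> ring
    rw [show l * (X ω - ν ω * |X ω|) - l ^ 2 * |X ω| / 2 =
      (-(l * (ν ω * |X ω|)) - l ^ 2 * |X ω| / 2) + l * X ω by ring, Real.exp_add, h1]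
    simp only [hW]
    ring
  have hi1 : Integrable (fun ω => W ω + (Real.cosh l - 1) * (W ω * |X ω|)) P :=
    hWi.add (hWa.const_mul _)
  rw [hexp]
  refine ⟨hi1.add (hWX.const_mul _), ?_⟩
  rw [integral_add hi1 (hWX.const_mul _), integral_const_mul, hpull, ← integral_const_mul,
    ← integral_add hi1 (hνX.const_mul _)]
  refine integral_mono (hi1.add (hνX.const_mul _)) hZi fun ω => ?_
  have hoef := cosh_add_mul_sinh_le_exp (hν1 ω) l
  have hcase : |X ω| = 0 ∨ |X ω| = 1 := by rcases hXval ω with h | h | h <;> simp [h]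
  rcases hcase with h | h
  · simp [hW, h]
  · simp only [hW, h, mul_one]
    rw [show -(l * ν ω) - l ^ 2 / 2 = -(l * ν ω + l ^ 2 / 2) by ring, Real.exp_neg]
    set E := Real.exp (l * ν ω + l ^ 2 / 2) with hE
    have hEpos : 0 < E := Real.exp_pos _
    calc _ = Z ω * (E⁻¹ * (Real.cosh l + ν ω * Real.sinh l)) := by ring
      _ ≤ Z ω * 1 := by
        refine mul_le_mul_of_nonneg_left ?_ (hZ0 ω)
        rw [inv_mul_le_one₀ hEpos]
        exact hoef
      _ = Z ω := mul_one _

/-- **Ville's inequality** for nonnegative processes that are supermartingales up to time `n`. -/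
lemma mul_measure_exists_le_lintegral {Ω : Type*} {F : MeasurableSpace Ω} (P : Measure Ω) (n : ℕ)
    (𝓕 : ℕ → MeasurableSpace Ω) (h𝓕mono : ∀ s t, s ≤ t → t ≤ n → 𝓕 s ≤ 𝓕 t)
    (h𝓕le : ∀ t ≤ n, 𝓕 t ≤ F) (M : ℕ → Ω → ℝ≥0∞) (hM : ∀ t ≤ n, Measurable[𝓕 t] (M t))
    (hstep : ∀ t < n, ∀ A, MeasurableSet[𝓕 t] A →
      ∫⁻ ω in A, M (t + 1) ω ∂P ≤ ∫⁻ ω in A, M t ω ∂P) (a : ℝ≥0∞) :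
    a * P {ω | ∃ t ≤ n, a ≤ M t ω} ≤ ∫⁻ ω, M 0 ω ∂P := by
  have hset : ∀ t ≤ n, MeasurableSet[𝓕 t] {ω | ∃ s ≤ t, a ≤ M s ω} := by
    intro t ht
    rw [show {ω | ∃ s ≤ t, a ≤ M s ω} = ⋃ s, ⋃ (_ : s ≤ t), {ω | a ≤ M s ω} by ext; simp]
    refine MeasurableSet.iUnion fun s => MeasurableSet.iUnion fun hs => ?_
    have hMs : Measurable[𝓕 t] (M s) := (hM s (hs.trans ht)).mono (h𝓕mono s t hs ht) le_rfl
    exact hMs measurableSet_Ici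
  have hsplit : ∀ f : Ω → ℝ≥0∞, Measurable f → ∀ C : Set Ω,
      a * P (C ∩ {ω | a ≤ f ω}) + ∫⁻ ω in C \ {ω | a ≤ f ω}, f ω ∂P ≤ ∫⁻ ω in C, f ω ∂P := by
    intro f hf C
    have hm : MeasurableSet {ω | a ≤ f ω} := hf measurableSet_Ici
    rw [← lintegral_inter_add_sdiff f C hm]
    gcongr
    rw [← setLIntegral_const]
    refine lintegral_mono_ae ?_
    have h := Measure.restrict_mono (μ := P)
      (Set.inter_subset_right : C ∩ {ω | a ≤ f ω} ⊆ _) le_rfl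
    exact (ae_mono h) (ae_restrict_mem hm)
  have main : ∀ t ≤ n, a * P {ω | ∃ s ≤ t, a ≤ M s ω} +
      ∫⁻ ω in {ω | ∃ s ≤ t, a ≤ M s ω}ᶜ, M t ω ∂P ≤ ∫⁻ ω, M 0 ω ∂P := by
    intro t
    induction t with
    | zero =>
      intro h0
      simpa [Set.compl_eq_univ_sdiff] using
        hsplit (M 0) ((hM 0 h0).mono (h𝓕le 0 h0) le_rfl) Set.univ
    | succ t ih =>
      intro ht
      have ht' : t ≤ n := by lia
      refine le_trans ?_ (ih ht')
      have hB := hset t ht'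
      set B : Set Ω := {ω | ∃ s ≤ t, a ≤ M s ω} with hBdef
      set D : Set Ω := {ω | a ≤ M (t + 1) ω} with hD
      have hMt := (hM (t + 1) ht).mono (h𝓕le _ ht) le_rfl
      have heq : {ω | ∃ s ≤ t + 1, a ≤ M s ω} = B ∪ (Bᶜ ∩ D) := by
        ext ω
        simp only [hBdef, hD, Set.mem_ofPred_eq, Set.mem_union, Set.mem_inter_iff,
          Set.mem_compl_iff, Nat.le_succ_iff]
        grind
      have hcompl : (B ∪ (Bᶜ ∩ D))ᶜ = Bᶜ \ D := by
        ext ω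
        simp only [Set.mem_compl_iff, Set.mem_union, Set.mem_inter_iff, Set.mem_sdiff]
        tauto
      rw [heq, hcompl]
      calc _ ≤ a * (P B + P (Bᶜ ∩ D)) + ∫⁻ ω in Bᶜ \ D, M (t + 1) ω ∂P := by
            gcongr; exact measure_union_le _ _
        _ = a * P B + (a * P (Bᶜ ∩ D) + ∫⁻ ω in Bᶜ \ D, M (t + 1) ω ∂P) := by ring
        _ ≤ a * P B + ∫⁻ ω in Bᶜ, M (t + 1) ω ∂P := by gcongr; exact hsplit _ hMt _
        _ ≤ a * P B + ∫⁻ ω in Bᶜ, M t ω ∂P :=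
            add_le_add le_rfl (hstep t (by lia) _ (MeasurableSet.compl hB))
  exact le_self_add.trans (main n le_rfl)

/-- The mixture `∫_{-2}^2 exp(λ x - λ² y / 2) dλ` of exponentials. -/
noncomputable def expMixture (x y : ℝ) : ℝ≥0∞ :=
  ∫⁻ l in Set.Icc (-2 : ℝ) 2, ENNReal.ofReal (Real.exp (l * x - l ^ 2 * y / 2))

lemma measurable_expMixture : Measurable fun p : ℝ × ℝ => expMixture p.1 p.2 := by
  unfold expMixture
  refine Measurable.lintegral_prod_right'
    (f := fun q : (ℝ × ℝ) × ℝ =>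
      ENNReal.ofReal (Real.exp (q.2 * q.1.1 - q.2 ^ 2 * q.1.2 / 2))) ?_
  fun_prop

lemma measurable_uncurry_exp {Ω : Type*} [MeasurableSpace Ω] {v w : Ω → ℝ}
    (hv : Measurable v) (hw : Measurable w) :
    Measurable (Function.uncurry fun (ω : Ω) (l : ℝ) =>
      ENNReal.ofReal (Real.exp (l * v ω - l ^ 2 * w ω / 2))) := by
  unfold Function.uncurry
  fun_prop

/-- One step of the mixture supermartingale. -/
lemma setLIntegral_expMixture_add_le {Ω : Type*} {m G F : MeasurableSpace Ω} {P : Measure Ω}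
    [IsProbabilityMeasure P] (hm : m ≤ G) (hG : G ≤ F)
    {X ν V N : Ω → ℝ} (hX : Measurable[F] X)
    (hXval : ∀ ω, X ω = -1 ∨ X ω = 0 ∨ X ω = 1)
    (hXabs : Measurable[G] fun ω => |X ω|) (hν : Measurable[G] ν) (hν1 : ∀ ω, |ν ω| ≤ 1)
    (hcond : P[X | G] =ᵐ[P] fun ω => ν ω * |X ω|)
    (hV : Measurable[m] V) {C : ℝ} (hVC : ∀ ω, |V ω| ≤ C)
    (hN : Measurable[m] N) (hN0 : ∀ ω, 0 ≤ N ω) {A : Set Ω} (hA : MeasurableSet[m] A) :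
    ∫⁻ ω in A, expMixture (V ω + (X ω - ν ω * |X ω|)) (N ω + |X ω|) ∂P ≤
      ∫⁻ ω in A, expMixture (V ω) (N ω) ∂P := by
  have hVF := hV.mono (hm.trans hG) le_rfl
  have hNF := hN.mono (hm.trans hG) le_rfl
  have hAF := hG A (hm A hA)
  simp only [expMixture]
  rw [lintegral_lintegral_swap (measurable_uncurry_exp
      (v := fun ω => V ω + (X ω - ν ω * |X ω|)) (w := fun ω => N ω + |X ω|)
      (hVF.add (hX.sub ((hν.mul hXabs).mono hG le_rfl)))
      (hNF.add (hXabs.mono hG le_rfl))).aemeasurable,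
    lintegral_lintegral_swap (measurable_uncurry_exp hVF hNF).aemeasurable]
  refine lintegral_mono fun l => ?_
  set Z : Ω → ℝ := A.indicator fun ω => Real.exp (l * V ω - l ^ 2 * N ω / 2) with hZ
  have hZm : Measurable[m] Z :=
    (Real.measurable_exp.comp ((hV.const_mul l).sub
      ((hN.const_mul (l ^ 2)).div_const 2))).indicator hA
  have hZ0 : ∀ ω, 0 ≤ Z ω := fun ω =>
    Set.indicator_nonneg (fun _ _ => (Real.exp_pos _).le) ω
  have hZC : ∀ ω, Z ω ≤ Real.exp (|l| * C) := by
    intro ω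
    refine Set.indicator_apply_le' (fun _ => Real.exp_le_exp.mpr ?_)
      fun _ => (Real.exp_pos _).le
    have h1 : l * V ω ≤ |l| * C := by
      refine (le_abs_self _).trans ?_
      rw [abs_mul]
      gcongr
      exact hVC ω
    have h2 : 0 ≤ l ^ 2 * N ω / 2 := by have := hN0 ω; positivity
    linarith
  obtain ⟨hint, hle⟩ := integral_mul_exp_le hG hX hXval hXabs hν hν1 hcond
    (hZm.mono hm le_rfl) hZ0 hZC l
  have hZi : Integrable Z P :=
    Integrable.of_bound (hZm.mono (hm.trans hG) le_rfl).aestronglyMeasurable _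
      (Filter.Eventually.of_forall fun ω => by
        rw [Real.norm_of_nonneg (hZ0 ω)]; exact hZC ω)
  rw [← lintegral_indicator hAF, ← lintegral_indicator hAF]
  calc _ = ∫⁻ ω, ENNReal.ofReal (Z ω *
        Real.exp (l * (X ω - ν ω * |X ω|) - l ^ 2 * |X ω| / 2)) ∂P := by
        refine lintegral_congr fun ω => ?_
        by_cases hω : ω ∈ A
        · simp only [hZ, Set.indicator_of_mem hω, ← Real.exp_add]
          ring_nf
        · simp [hZ, hω]
    _ = ENNReal.ofReal (∫ ω, Z ω *
        Real.exp (l * (X ω - ν ω * |X ω|) - l ^ 2 * |X ω| / 2) ∂P) :=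
        (ofReal_integral_eq_lintegral_ofReal hint (Filter.Eventually.of_forall fun ω =>
          mul_nonneg (hZ0 ω) (Real.exp_pos _).le)).symm
    _ ≤ ENNReal.ofReal (∫ ω, Z ω ∂P) := ENNReal.ofReal_le_ofReal hle
    _ = ∫⁻ ω, ENNReal.ofReal (Z ω) ∂P :=
        ofReal_integral_eq_lintegral_ofReal hZi (Filter.Eventually.of_forall hZ0)
    _ = _ := by
        refine lintegral_congr fun ω => ?_
        by_cases hω : ω ∈ A <;> simp [hZ, hω]

lemma Measurable.expMixture {Ω : Type*} {m : MeasurableSpace Ω} {v w : Ω → ℝ}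
    (hv : Measurable v) (hw : Measurable w) : Measurable fun ω => expMixture (v ω) (w ω) :=
  measurable_expMixture.comp (hv.prodMk hw)

lemma erf_sqrt_two_pos : 0 < erf (Real.sqrt 2) := by
  unfold erf
  refine mul_pos (by positivity) (intervalIntegral.intervalIntegral_pos_of_pos ?_ ?_ ?_)
  · exact (by fun_prop : Continuous fun t : ℝ => Real.exp (-t ^ 2)).intervalIntegrable _ _
  · exact fun _ => Real.exp_pos _
  · positivity

lemma erf_le_integral_exp {y : ℝ} (hy : 1 ≤ y) :
    Real.sqrt (2 / y) * (Real.sqrt Real.pi / 2 * erf (Real.sqrt 2)) ≤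
      ∫ u in (0 : ℝ)..2, Real.exp (-(y * u ^ 2 / 2)) := by
  have hy0 : 0 < y := by linarith
  have hk : Real.sqrt (y / 2) ≠ 0 := by positivity
  have h1 := intervalIntegral.integral_comp_mul_left (a := 0) (b := 2)
    (fun v : ℝ => Real.exp (-v ^ 2)) hk
  have h2 : (fun u : ℝ => Real.exp (-(Real.sqrt (y / 2) * u) ^ 2)) =
      fun u => Real.exp (-(y * u ^ 2 / 2)) := by
    funext u
    rw [mul_pow, Real.sq_sqrt (by positivity)]
    ring_nf
  rw [h2, mul_zero, smul_eq_mul, ← Real.sqrt_inv, inv_div] at h1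
  rw [h1]
  gcongr
  have h3 : Real.sqrt Real.pi / 2 * erf (Real.sqrt 2) =
      ∫ t in (0 : ℝ)..Real.sqrt 2, Real.exp (-t ^ 2) := by
    have : Real.sqrt Real.pi ≠ 0 := by positivity
    rw [erf]
    field_simp
  rw [h3]
  refine intervalIntegral.integral_mono_interval le_rfl (by positivity) ?_
    (Filter.Eventually.of_forall fun _ => (Real.exp_pos _).le)
    ((by fun_prop : Continuous fun t : ℝ => Real.exp (-t ^ 2)).intervalIntegrable _ _)
  rw [Real.sqrt_le_left (by positivity), mul_pow, Real.sq_sqrt (by positivity)]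
  linarith

lemma le_expMixture {x y : ℝ} (hy : 1 ≤ y) (hx : |x| ≤ 2 * y) :
    ENNReal.ofReal (Real.exp (x ^ 2 / (2 * y)) *
      (Real.sqrt (2 / y) * (Real.sqrt Real.pi / 2 * erf (Real.sqrt 2)))) ≤ expMixture x y := by
  have hy0 : 0 < y := by linarith
  obtain ⟨hx1, hx2⟩ := abs_le.mp hx
  set m := x / y with hm
  have hm1 : -2 ≤ m := by rw [hm, le_div_iff₀ hy0]; linarith
  have hm2 : m ≤ 2 := by rw [hm, div_le_iff₀ hy0]; linarith
  have hxm : x = m * y := by rw [hm]; field_simp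
  have hsq : ∀ l : ℝ, l * x - l ^ 2 * y / 2 = x ^ 2 / (2 * y) + -(y * (m - l) ^ 2 / 2) := by
    intro l
    rw [hxm]
    field_simp
    ring
  have hcont : Continuous fun l : ℝ => Real.exp (l * x - l ^ 2 * y / 2) := by fun_prop
  have hshift : ∀ a b : ℝ, ∫ l in a..b, Real.exp (l * x - l ^ 2 * y / 2) =
      Real.exp (x ^ 2 / (2 * y)) *
        ∫ u in (m - b)..(m - a), Real.exp (-(y * u ^ 2 / 2)) := by
    intro a b
    rw [← intervalIntegral.integral_comp_sub_left
      (fun u => Real.exp (-(y * u ^ 2 / 2))) m, ← intervalIntegral.integral_const_mul]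
    simp only [hsq, Real.exp_add]
  have hmix : expMixture x y =
      ENNReal.ofReal (∫ l in (-2 : ℝ)..2, Real.exp (l * x - l ^ 2 * y / 2)) := by
    rw [expMixture, intervalIntegral.integral_of_le (by norm_num),
      ← integral_Icc_eq_integral_Ioc, ofReal_integral_eq_lintegral_ofReal]
    · exact hcont.continuousOn.integrableOn_compact isCompact_Icc
    · exact Filter.Eventually.of_forall fun _ => (Real.exp_pos _).le
  rw [hmix]
  refine ENNReal.ofReal_le_ofReal ?_
  rw [hshift]
  refine mul_le_mul_of_nonneg_left ((erf_le_integral_exp hy).trans ?_) (Real.exp_pos _).le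
  have hgi : ∀ a b : ℝ, IntervalIntegrable (fun u : ℝ => Real.exp (-(y * u ^ 2 / 2))) volume a b :=
    fun a b => (by fun_prop : Continuous fun u : ℝ =>
      Real.exp (-(y * u ^ 2 / 2))).intervalIntegrable _ _
  have hg0 : ∀ s : Set ℝ, 0 ≤ᵐ[volume.restrict s] fun u : ℝ => Real.exp (-(y * u ^ 2 / 2)) :=
    fun s => Filter.Eventually.of_forall fun _ => (Real.exp_pos _).le
  rcases le_total 0 m with h | h
  · exact intervalIntegral.integral_mono_interval (by linarith) (by norm_num) (by linarith)
      (hg0 _) (hgi _ _)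
  · have hneg := intervalIntegral.integral_comp_neg (a := 0) (b := 2)
      (fun u : ℝ => Real.exp (-(y * u ^ 2 / 2)))
    simp only [even_two.neg_pow, neg_zero] at hneg
    rw [hneg]
    exact intervalIntegral.integral_mono_interval (by linarith) (by norm_num) (by linarith)
      (hg0 _) (hgi _ _)

/-- The self-normalized boundary is reached only where the mixture is at least `4 / δ`. -/
lemma four_div_le_expMixture {x y δ c : ℝ} (hδ : 0 < δ)
    (hc : c = 4 * Real.sqrt (2 / Real.pi) / erf (Real.sqrt 2)) (hy : 1 ≤ y)
    (hx : |x| ≤ 2 * y)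
    (h : Real.sqrt (2 * y * Real.log (c * Real.sqrt y / δ)) ≤ |x|) :
    ENNReal.ofReal (4 / δ) ≤ expMixture x y := by
  have hy0 : 0 < y := by linarith
  have herf := erf_sqrt_two_pos
  have hcpos : 0 < c := by rw [hc]; positivity
  refine le_trans (ENNReal.ofReal_le_ofReal ?_) (le_expMixture hy hx)
  rw [Real.sqrt_le_left (abs_nonneg x), sq_abs] at h
  have h1 : Real.log (c * Real.sqrt y / δ) ≤ x ^ 2 / (2 * y) := by
    rw [le_div_iff₀ (by positivity)]
    linarith
  have h2 : c * Real.sqrt y / δ ≤ Real.exp (x ^ 2 / (2 * y)) := by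
    rw [← Real.log_le_iff_le_exp (by positivity)]
    exact h1
  have h3 : Real.sqrt (2 / y) * (Real.sqrt Real.pi / 2 * erf (Real.sqrt 2)) =
      4 / (c * Real.sqrt y) := by
    rw [hc, Real.sqrt_div zero_le_two, Real.sqrt_div zero_le_two]
    have : Real.sqrt 2 ^ 2 = 2 := Real.sq_sqrt zero_le_two
    field_simp
    linarith
  calc 4 / δ = c * Real.sqrt y / δ * (4 / (c * Real.sqrt y)) := by field_simp
    _ ≤ _ := by rw [h3]; gcongr

/-- Lemma 6 of the paper: a self-normalized maximal
concentration inequality. The random variables `X 1, …, X n` take values in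
`{−1, 0, 1}`, `X t` is `𝓕 t`-measurable for the filtration `𝓕 0 ≤ ⋯ ≤ 𝓕 n`,
`G t` is generated by `𝓕 (t−1)` together with `|X t|`, and `μ t` is a
`G t`-measurable version of `E[X t | 𝓕 (t−1), X t ≠ 0]`, i.e.
`E[X t | G t] = μ t · |X t|` a.s. with `|μ t| ≤ 1` a.s. With
`S t = Σ_{s=1}^t (X s − μ s·|X s|)` and `N t = Σ_{s=1}^t |X s|`, for every
`δ ∈ (0,1)` and `c = 4√(2/π)/erf(√2)`, the probability that there exists
`t ≤ n` with `N t > 0` and `|S t| ≥ √(2 N t log(c √(N t)/δ))` is at most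
`δ`. -/
theorem stmt7 {Ω : Type*} {F : MeasurableSpace Ω} (P : Measure Ω)
    [IsProbabilityMeasure P] (n : ℕ) (hn : 1 ≤ n)
    (𝓕 : ℕ → MeasurableSpace Ω)
    (h𝓕mono : ∀ s t, s ≤ t → t ≤ n → 𝓕 s ≤ 𝓕 t)
    (h𝓕le : ∀ t ≤ n, 𝓕 t ≤ F)
    (X : ℕ → Ω → ℝ)
    (hXmeas : ∀ t, 1 ≤ t → t ≤ n → Measurable[𝓕 t] (X t))
    (hXval : ∀ t ω, 1 ≤ t → t ≤ n → X t ω = -1 ∨ X t ω = 0 ∨ X t ω = 1)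
    (G : ℕ → MeasurableSpace Ω)
    (hGdef : ∀ t, 1 ≤ t → t ≤ n → G t =
      𝓕 (t - 1) ⊔ MeasurableSpace.comap (fun ω => |X t ω|) inferInstance)
    (hGle : ∀ t, 1 ≤ t → t ≤ n → G t ≤ F)
    (μ : ℕ → Ω → ℝ)
    (hμmeas : ∀ t, 1 ≤ t → t ≤ n → Measurable[G t] (μ t))
    (hμbdd : ∀ t, 1 ≤ t → t ≤ n → ∀ᵐ ω ∂P, |μ t ω| ≤ 1)
    (hcond : ∀ t, 1 ≤ t → t ≤ n →
      P[X t | G t] =ᵐ[P] fun ω => μ t ω * |X t ω|)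
    (S N : ℕ → Ω → ℝ)
    (hS : ∀ t ω, S t ω = ∑ s ∈ Finset.Icc 1 t, (X s ω - μ s ω * |X s ω|))
    (hN : ∀ t ω, N t ω = ∑ s ∈ Finset.Icc 1 t, |X s ω|)
    (δ : ℝ) (hδ0 : 0 < δ) (hδ1 : δ < 1)
    (c : ℝ) (hc : c = 4 * Real.sqrt (2 / Real.pi) / erf (Real.sqrt 2)) :
    P {ω | ∃ t, 1 ≤ t ∧ t ≤ n ∧ 0 < N t ω ∧
        Real.sqrt (2 * N t ω * Real.log (c * Real.sqrt (N t ω) / δ)) ≤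
          |S t ω|} ≤ ENNReal.ofReal δ := by
  set ν : ℕ → Ω → ℝ := fun t ω => max (-1) (min 1 (μ t ω)) with hνdef
  set V : ℕ → Ω → ℝ := fun t ω => ∑ s ∈ Finset.Icc 1 t, (X s ω - ν s ω * |X s ω|) with hV
  have hν1 : ∀ t ω, |ν t ω| ≤ 1 := fun t ω =>
    abs_le.mpr ⟨le_max_left _ _, max_le (by norm_num) (min_le_left _ _)⟩
  have hνμ : ∀ t, 1 ≤ t → t ≤ n → ν t =ᵐ[P] μ t := by
    intro t h1 h2
    filter_upwards [hμbdd t h1 h2] with ω h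
    obtain ⟨ha, hb⟩ := abs_le.mp h
    simp only [hνdef, min_eq_right hb, max_eq_right ha]
  have hνm : ∀ t, 1 ≤ t → t ≤ n → Measurable[G t] (ν t) := fun t h1 h2 =>
    measurable_const.max (measurable_const.min (hμmeas t h1 h2))
  have h𝓕G : ∀ t, 1 ≤ t → t ≤ n → 𝓕 (t - 1) ≤ G t := fun t h1 h2 => by
    rw [hGdef t h1 h2]; exact le_sup_left
  have hXabs : ∀ t, 1 ≤ t → t ≤ n → Measurable[G t] fun ω => |X t ω| := by
    intro t h1 h2
    rw [hGdef t h1 h2]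
    exact (comap_measurable _).mono le_sup_right le_rfl
  have hG𝓕 : ∀ t, 1 ≤ t → t ≤ n → G t ≤ 𝓕 t := by
    intro t h1 h2
    rw [hGdef t h1 h2]
    exact sup_le (h𝓕mono _ _ (by lia) h2)
      (Measurable.comap_le (continuous_abs.measurable.comp (hXmeas t h1 h2)))
  have hVm : ∀ t ≤ n, Measurable[𝓕 t] (V t) := by
    intro t ht
    refine Finset.measurable_fun_sum _ fun s hs => ?_
    obtain ⟨h1, h2⟩ := Finset.mem_Icc.mp hs
    have h3 := h2.trans ht
    have h4 := h𝓕mono s t h2 ht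
    exact ((hXmeas s h1 h3).mono h4 le_rfl).sub
      (((hνm s h1 h3).mul (hXabs s h1 h3)).mono ((hG𝓕 s h1 h3).trans h4) le_rfl)
  have hNm : ∀ t ≤ n, Measurable[𝓕 t] (N t) := by
    intro t ht
    rw [show N t = fun ω => ∑ s ∈ Finset.Icc 1 t, |X s ω| from funext (hN t)]
    refine Finset.measurable_fun_sum _ fun s hs => ?_
    obtain ⟨h1, h2⟩ := Finset.mem_Icc.mp hs
    exact (hXabs s h1 (h2.trans ht)).mono
      ((hG𝓕 s h1 (h2.trans ht)).trans (h𝓕mono s t h2 ht)) le_rfl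
  have hXle : ∀ t ω, 1 ≤ t → t ≤ n → |X t ω| ≤ 1 := fun t ω h1 h2 => by
    rcases hXval t ω h1 h2 with h | h | h <;> simp [h]
  have hVN : ∀ t ω, |V t ω| ≤ 2 * N t ω := by
    intro t ω
    rw [hN, Finset.mul_sum]
    refine (Finset.abs_sum_le_sum_abs _ _).trans (Finset.sum_le_sum fun s _ => ?_)
    calc _ ≤ |X s ω| + abs (ν s ω * |X s ω|) := abs_sub _ _
      _ = |X s ω| + |ν s ω| * |X s ω| := by rw [abs_mul, abs_abs]
      _ ≤ |X s ω| + 1 * |X s ω| := by gcongr; exact hν1 s ω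
      _ = 2 * |X s ω| := by ring
  have hN0 : ∀ t ω, 0 ≤ N t ω := fun t ω => by
    rw [hN]; exact Finset.sum_nonneg fun _ _ => abs_nonneg _
  have hNn : ∀ t ≤ n, ∀ ω, N t ω ≤ n := by
    intro t ht ω
    rw [hN]
    calc _ ≤ ∑ s ∈ Finset.Icc 1 t, (1 : ℝ) := Finset.sum_le_sum fun s hs => by
            obtain ⟨h1, h2⟩ := Finset.mem_Icc.mp hs
            exact hXle s ω h1 (h2.trans ht)
      _ ≤ n := by simpa using ht
  have hN1 : ∀ t ≤ n, ∀ ω, 0 < N t ω → 1 ≤ N t ω := by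
    intro t ht ω h
    rw [hN] at h ⊢
    obtain ⟨s, hs, hs0⟩ := Finset.exists_ne_zero_of_sum_ne_zero h.ne'
    obtain ⟨h1, h2⟩ := Finset.mem_Icc.mp hs
    have : |X s ω| = 1 := by
      rcases hXval s ω h1 (h2.trans ht) with h | h | h <;> simp [h] at hs0 ⊢
    rw [← this]
    exact Finset.single_le_sum (f := fun s => |X s ω|) (fun _ _ => abs_nonneg _) hs
  have hstep : ∀ t < n, ∀ A, MeasurableSet[𝓕 t] A →
      ∫⁻ ω in A, expMixture (V (t + 1) ω) (N (t + 1) ω) ∂P ≤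
        ∫⁻ ω in A, expMixture (V t ω) (N t ω) ∂P := by
    intro t ht A hA
    have ht1 : 1 ≤ t + 1 := by lia
    have hcondν : P[X (t + 1) | G (t + 1)] =ᵐ[P]
        fun ω => ν (t + 1) ω * |X (t + 1) ω| := by
      filter_upwards [hcond _ ht1 ht, hνμ _ ht1 ht] with ω h1 h2
      rw [h1, h2]
    have hVC : ∀ ω, |V t ω| ≤ 2 * n := fun ω => by
      linarith [hVN t ω, hNn t ht.le ω]
    have hVs : V (t + 1) = fun ω =>
        V t ω + (X (t + 1) ω - ν (t + 1) ω * |X (t + 1) ω|) :=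
      funext fun ω => Finset.sum_Icc_succ_top ht1 _
    have hNs : N (t + 1) = fun ω => N t ω + |X (t + 1) ω| := by
      funext ω
      rw [hN, hN, Finset.sum_Icc_succ_top ht1]
    have h𝓕G' : 𝓕 t ≤ G (t + 1) := h𝓕G (t + 1) ht1 ht
    simp only [hVs, hNs]
    exact setLIntegral_expMixture_add_le h𝓕G' (hGle _ ht1 ht)
      ((hXmeas _ ht1 ht).mono (h𝓕le _ ht) le_rfl) (fun ω => hXval _ ω ht1 ht)
      (hXabs _ ht1 ht) (hνm _ ht1 ht) (hν1 _) hcondν (hVm t ht.le) hVC (hNm t ht.le)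
      (hN0 t) hA
  have hMm : ∀ t ≤ n, Measurable[𝓕 t] fun ω => expMixture (V t ω) (N t ω) :=
    fun t ht => (hVm t ht).expMixture (hNm t ht)
  have hville := mul_measure_exists_le_lintegral P n 𝓕 h𝓕mono h𝓕le
    (fun t ω => expMixture (V t ω) (N t ω)) hMm hstep (ENNReal.ofReal (4 / δ))
  have hM0 : ∫⁻ ω, expMixture (V 0 ω) (N 0 ω) ∂P = ENNReal.ofReal 4 := by
    simp only [hV, hN, expMixture]
    norm_num
  rw [hM0] at hville
  have hSV : ∀ᵐ ω ∂P, ∀ t ≤ n, S t ω = V t ω := by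
    have : ∀ᵐ ω ∂P, ∀ t, 1 ≤ t → t ≤ n → ν t ω = μ t ω := by
      simp only [ae_all_iff]
      exact hνμ
    filter_upwards [this] with ω h t ht
    simp only [hS, hV]
    refine Finset.sum_congr rfl fun s hs => ?_
    obtain ⟨h1, h2⟩ := Finset.mem_Icc.mp hs
    rw [h s h1 (h2.trans ht)]
  have hsub : P {ω | ∃ t, 1 ≤ t ∧ t ≤ n ∧ 0 < N t ω ∧
        Real.sqrt (2 * N t ω * Real.log (c * Real.sqrt (N t ω) / δ)) ≤ |S t ω|} ≤
      P {ω | ∃ t ≤ n, ENNReal.ofReal (4 / δ) ≤ expMixture (V t ω) (N t ω)} := by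
    refine measure_mono_ae ?_
    filter_upwards [hSV] with ω h
    rintro ⟨t, -, ht, hpos, hle⟩
    rw [h t ht] at hle
    exact ⟨t, ht, four_div_le_expMixture hδ0 hc (hN1 t ht ω hpos) (hVN t ω) hle⟩
  refine hsub.trans ?_
  rw [mul_comm] at hville
  have h4 : (0 : ℝ) < 4 / δ := by positivity
  rw [← ENNReal.le_div_iff_mul_le (Or.inl (by simpa using h4))
    (Or.inl ENNReal.ofReal_ne_top), ← ENNReal.ofReal_div_of_pos h4] at hville
  rwa [div_div_cancel₀ (by norm_num)] at hville
end

section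
/- Let L ≥ 1, let β : [L] → [0,1], and let χ assign to every permutation a of [L] = {1,…,L} and every position k ∈ [L] a value χ(a,k) ∈ [0,1]. Assume: (i) for all permutations a, a' and every position k, if {a(1),…,a(k−1)} = {a'(1),…,a'(k−1)} as sets then χ(a,k) = χ(a',k); and (ii) for all items i, j with β(i) ≥ β(j) and every permutation a with a⁻¹(i) > a⁻¹(j), χ(a, a⁻¹(i)) ≥ χ(σ∘a, a⁻¹(i)), where σ is the transposition of [L] exchanging i and j and (σ∘a)(k) = σ(a(k)). Fix any permutation a₀ and define α(i) = β(i)·χ(a₀,1) and v(a,k) = β(a(k))·χ(a,k). Then for all items i, j with α(i) ≥ α(j) and every permutation a, α(j)·v(a, a⁻¹(i)) ≥ α(i)·v(σ∘a, a⁻¹(i)), where σ is the transposition exchanging i and j. -/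
/-- Appendix A of the paper: the factored click model
`v(a,k) = β(a(k))·χ(a,k)` of Zoghi et al. satisfies the paper's
Assumption 3 in cross-multiplied form, with `α(i) = β(i)·χ(a₀,1)`.
Permutations act so that `a k` is the item at position `k`, `a.symm i` is
the position of item `i`, and `Equiv.swap i j * a` is the permutation
`σ ∘ a` with `(σ ∘ a) k = σ (a k)`. The first position is `(0 : Fin L)`
and `{a(1),…,a(k−1)}` is the image under `a` of the positions below `k`. -/
theorem stmt14 (L : ℕ) (hL : 1 ≤ L) (β : Fin L → ℝ)
    (hβ0 : ∀ i, 0 ≤ β i) (hβ1 : ∀ i, β i ≤ 1)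
    (χ : Equiv.Perm (Fin L) → Fin L → ℝ)
    (hχ0 : ∀ a k, 0 ≤ χ a k) (hχ1 : ∀ a k, χ a k ≤ 1)
    (hset : ∀ (a a' : Equiv.Perm (Fin L)) (k : Fin L),
      (Finset.univ.filter (fun k' : Fin L => k' < k)).image a =
        (Finset.univ.filter (fun k' : Fin L => k' < k)).image a' →
      χ a k = χ a' k)
    (hswap : ∀ (i j : Fin L) (a : Equiv.Perm (Fin L)),
      β i ≥ β j → a.symm j < a.symm i →
      χ a (a.symm i) ≥ χ (Equiv.swap i j * a) (a.symm i))
    (a₀ : Equiv.Perm (Fin L))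
    (α : Fin L → ℝ) (hα : ∀ i, α i = β i * χ a₀ ⟨0, hL⟩)
    (v : Equiv.Perm (Fin L) → Fin L → ℝ)
    (hv : ∀ a k, v a k = β (a k) * χ a k) :
    ∀ (i j : Fin L) (a : Equiv.Perm (Fin L)), α i ≥ α j →
      α j * v a (a.symm i) ≥ α i * v (Equiv.swap i j * a) (a.symm i) := by
  intro i j a hij
  rw [hα, hα] at hij
  have hχ : 0 ≤ χ a₀ ⟨0, hL⟩ := hχ0 _ _
  rcases hχ.eq_or_lt with h0 | hpos
  · simp [hα, ← h0]
  have hβ : β i ≥ β j := le_of_mul_le_mul_right hij hpos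
  have key : χ (Equiv.swap i j * a) (a.symm i) ≤ χ a (a.symm i) := by
    rcases lt_or_ge (a.symm j) (a.symm i) with hlt | hle
    · exact hswap i j a hβ hlt
    · refine (hset _ _ _ (Finset.image_congr fun k hk => ?_)).le
      have hk' : k < a.symm i := by simpa using hk
      refine Equiv.swap_apply_of_ne_of_ne ?_ ?_
      · rintro rfl
        simp at hk'
      · rintro rfl
        simp only [Equiv.symm_apply_apply] at hle
        exact absurd hk' hle.not_gt
  have hvi : v a (a.symm i) = β i * χ a (a.symm i) := by simp [hv]
  have hvj : v (Equiv.swap i j * a) (a.symm i) =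
      β j * χ (Equiv.swap i j * a) (a.symm i) := by simp [hv]
  rw [hvi, hvj, hα, hα]
  have := mul_le_mul_of_nonneg_left key (mul_nonneg (mul_nonneg (hβ0 i) (hβ0 j)) hχ)
  linarith
end
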